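/- Fix ω > 0. For all ξ₁, ξ₂ ∈ ℝ with ξ₁ + ξ₂ ≠ 0, one has ∫_ℝ ( Ψ₁,ω(x,ξ₁) Ψ₂,ω(x,ξ₂) − Ψ₂,ω(x,ξ₁) Ψ₁,ω(x,ξ₂) ) φ_ω(x)² dx = (ξ₁² − ξ₂²) · (1/12) · ( (ξ₁² + 2ξ₁ξ₂ + ξ₂² + 4ω) / ( (|ξ₁| − i√ω)² (|ξ₂| − i√ω)² ) ) · (ξ₁ + ξ₂) · cosech( (π/2) · (ξ₁+ξ₂)/√ω ). In particular, this quadratic spectral distribution carries the null factor (ξ₁² − ξ₂²), which cancels the time resonance in the modulation equations. -/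

import Mathlib

open MeasureTheory

/-- `sech x = 1 / cosh x`. -/
noncomputable def sech (x : ℝ) : ℝ := 1 / Real.cosh x

/-- `cosech y = 1 / sinh y`. -/
noncomputable def cosech (y : ℝ) : ℝ := 1 / Real.sinh y

/-- The ground state `φ_ω(x) = √(2ω) sech(√ω x)`. -/
noncomputable def phi (ω x : ℝ) : ℝ := Real.sqrt (2 * ω) * sech (Real.sqrt ω * x)

/-- `Ψ₁,ω(x,ξ) = (2π)^{−1/2} (ξ + i√ω tanh(√ω x))² (|ξ| − i√ω)^{−2} e^{ixξ}`. -/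
noncomputable def Psi1 (ω x ξ : ℝ) : ℂ :=
  ((Real.sqrt (2 * Real.pi) : ℝ) : ℂ)⁻¹ *
    ((ξ : ℂ) + Complex.I * ((Real.sqrt ω : ℝ) : ℂ) *
        ((Real.tanh (Real.sqrt ω * x) : ℝ) : ℂ)) ^ 2 /
      (((|ξ| : ℝ) : ℂ) - Complex.I * ((Real.sqrt ω : ℝ) : ℂ)) ^ 2 *
    Complex.exp (Complex.I * x * ξ)

/-- `Ψ₂,ω(x,ξ) = (2π)^{−1/2} ω sech²(√ω x) (|ξ| − i√ω)^{−2} e^{ixξ}`. -/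
noncomputable def Psi2 (ω x ξ : ℝ) : ℂ :=
  ((Real.sqrt (2 * Real.pi) : ℝ) : ℂ)⁻¹ *
    ((ω : ℂ) * ((sech (Real.sqrt ω * x) ^ 2 : ℝ) : ℂ)) /
      (((|ξ| : ℝ) : ℂ) - Complex.I * ((Real.sqrt ω : ℝ) : ℂ)) ^ 2 *
    Complex.exp (Complex.I * x * ξ)

theorem sech_sq_le_inv_one_add_sq (y : ℝ) : sech y ^ 2 ≤ (1 + y ^ 2)⁻¹ := by
  have hy : y ^ 2 ≤ Real.sinh y ^ 2 := by
    have h : |y| ≤ |Real.sinh y| := by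
      rw [Real.abs_sinh]
      exact Real.self_le_sinh_iff.2 (abs_nonneg y)
    exact sq_le_sq.2 h
  rw [sech, one_div, inv_pow]
  refine inv_anti₀ (by positivity) ?_
  rw [Real.cosh_sq]
  linarith

theorem sech_pos (y : ℝ) : 0 < sech y := one_div_pos.2 (Real.cosh_pos y)

theorem sech_le_one (y : ℝ) : sech y ≤ 1 :=
  div_le_one_of_le₀ (Real.one_le_cosh y) (Real.cosh_pos y).le

theorem continuous_sech : Continuous sech :=
  continuous_const.div Real.continuous_cosh fun y => (Real.cosh_pos y).ne'

theorem continuous_tanh : Continuous Real.tanh := by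
  rw [funext Real.tanh_eq_sinh_div_cosh]
  exact Real.continuous_sinh.div Real.continuous_cosh fun y => (Real.cosh_pos y).ne'

theorem integrable_sech_pow_four : Integrable fun y : ℝ => sech y ^ 4 := by
  refine integrable_inv_one_add_sq.mono' (continuous_sech.pow 4).aestronglyMeasurable
    (Filter.Eventually.of_forall fun y => ?_)
  rw [Real.norm_of_nonneg (by have := sech_pos y; positivity)]
  exact (pow_le_pow_of_le_one (sech_pos y).le (sech_le_one y) (by norm_num)).trans
    (sech_sq_le_inv_one_add_sq y)

theorem hasDerivAt_sech (y : ℝ) : HasDerivAt sech (-(Real.tanh y * sech y)) y := by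
  have hc := (Real.cosh_pos y).ne'
  convert! (hasDerivAt_const y (1 : ℝ)).div (Real.hasDerivAt_cosh y) hc using 1
  rw [Real.tanh_eq_sinh_div_cosh, sech]
  field_simp
  ring

theorem sigmoid_mul_one_sub_sigmoid (y : ℝ) :
    Real.sigmoid (2 * y) * (1 - Real.sigmoid (2 * y)) = sech y ^ 2 / 4 := by
  have hy : Real.exp (-(2 * y)) = Real.exp (-y) ^ 2 := by
    rw [← Real.exp_nat_mul]
    congr 1
    push_cast
    ring
  have he : Real.exp y = (Real.exp (-y))⁻¹ := by rw [← Real.exp_neg, neg_neg]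
  have hp := Real.exp_pos (-y)
  rw [Real.sigmoid_def, sech, Real.cosh_eq, hy, he]
  field_simp
  ring

theorem ofReal_sigmoid_cpow_mul (x : ℝ) (z : ℂ) :
    (Real.sigmoid x : ℂ) ^ (1 + z) * (1 - (Real.sigmoid x : ℂ)) ^ (1 - z) =
      ((Real.sigmoid x * (1 - Real.sigmoid x) : ℝ) : ℂ) * Complex.exp (z * x) := by
  have hs := Real.sigmoid_pos x
  have ht : 0 < 1 - Real.sigmoid x := sub_pos.2 (Real.sigmoid_lt_one x)
  have hlog : Real.log (1 - Real.sigmoid x) = Real.log (Real.sigmoid x) - x := by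
    rw [← Real.sigmoid_neg, ← Real.sigmoid_mul_rexp_neg,
      Real.log_mul hs.ne' (Real.exp_pos _).ne', Real.log_exp, sub_eq_add_neg]
  have hs0 : (Real.sigmoid x : ℂ) ≠ 0 := by exact_mod_cast hs.ne'
  have ht0 : (1 - (Real.sigmoid x : ℂ)) ≠ 0 := by exact_mod_cast ht.ne'
  have hlog' : Complex.log (1 - (Real.sigmoid x : ℂ)) =
      Complex.log (Real.sigmoid x : ℂ) - x := by
    rw [← Complex.ofReal_one, ← Complex.ofReal_sub, ← Complex.ofReal_log ht.le,
      ← Complex.ofReal_log hs.le, hlog, Complex.ofReal_sub]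
  rw [Complex.cpow_add _ _ hs0, Complex.cpow_sub _ _ ht0, Complex.cpow_one, Complex.cpow_one,
    Complex.cpow_def_of_ne_zero hs0 z, Complex.cpow_def_of_ne_zero ht0 z, hlog', div_eq_mul_inv,
    ← Complex.exp_neg]
  rw [show z * (x : ℂ) = Complex.log (Real.sigmoid x : ℂ) * z +
    -((Complex.log (Real.sigmoid x : ℂ) - x) * z) by ring, Complex.exp_add]
  push_cast
  ring

theorem betaIntegral_eq_integral_sigmoid (z : ℂ) :
    Complex.betaIntegral (2 + z) (2 - z) =
      ∫ x : ℝ, (((Real.sigmoid x * (1 - Real.sigmoid x)) ^ 2 : ℝ) : ℂ) * Complex.exp (z * x) := by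
  rw [Complex.betaIntegral, intervalIntegral.integral_of_le zero_le_one,
    integral_Ioc_eq_integral_Ioo, ← Real.range_sigmoid, ← Set.image_univ,
    integral_image_eq_integral_abs_deriv_smul MeasurableSet.univ
      (fun x _ => (Real.hasDerivAt_sigmoid x).hasDerivWithinAt)
      Real.sigmoid_injective.injOn, setIntegral_univ]
  refine integral_congr_ae (Filter.Eventually.of_forall fun x => ?_)
  have hs := Real.sigmoid_pos x
  have ht : 0 < 1 - Real.sigmoid x := sub_pos.2 (Real.sigmoid_lt_one x)
  dsimp only
  rw [abs_of_pos (mul_pos hs ht), show 2 + z - 1 = 1 + z by ring,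
    show 2 - z - 1 = 1 - z by ring, ofReal_sigmoid_cpow_mul, Complex.real_smul]
  push_cast
  ring

theorem betaIntegral_two_add_two_sub {z : ℂ} (hz : z.re = 0) (hz0 : z ≠ 0) :
    Complex.betaIntegral (2 + z) (2 - z) =
      (1 - z ^ 2) * z * Real.pi / (6 * Complex.sin (Real.pi * z)) := by
  have h1 : 1 + z ≠ 0 := fun h => by simpa [hz] using congrArg Complex.re h
  have h2 : 1 - z ≠ 0 := fun h => by simpa [hz] using congrArg Complex.re h
  have hG4 : Complex.Gamma 4 = 6 := by
    rw [show (4 : ℂ) = ((3 : ℕ) : ℂ) + 1 by norm_num, Complex.Gamma_nat_eq_factorial]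
    norm_num [Nat.factorial]
  have hB := Complex.Gamma_mul_Gamma_eq_betaIntegral (s := 2 + z) (t := 2 - z)
    (by simp [hz]) (by simp [hz])
  rw [show 2 + z = z + 1 + 1 by ring, show 2 - z = 1 - z + 1 by ring,
    Complex.Gamma_add_one (z + 1) (by rwa [add_comm]), Complex.Gamma_add_one z hz0,
    Complex.Gamma_add_one (1 - z) h2, show z + 1 + 1 + (1 - z + 1) = 4 by ring, hG4] at hB
  have hR := Complex.Gamma_mul_Gamma_one_sub z
  rw [show 2 + z = z + 1 + 1 by ring, show 2 - z = 1 - z + 1 by ring, mul_comm 6 (Complex.sin _),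
    ← div_div, mul_div_assoc, ← hR]
  linear_combination (-1 / 6 : ℂ) * hB

theorem integral_sech_pow_four_mul_exp {k : ℝ} (hk : k ≠ 0) :
    (∫ y : ℝ, ((sech y ^ 4 : ℝ) : ℂ) * Complex.exp (Complex.I * k * y)) =
      ((Real.pi * k * (k ^ 2 + 4) / 6 * cosech (Real.pi / 2 * k) : ℝ) : ℂ) := by
  set z : ℂ := Complex.I * k / 2 with hz
  have hz0 : z ≠ 0 := by simp [hz, hk]
  have hI := betaIntegral_eq_integral_sigmoid z
  rw [betaIntegral_two_add_two_sub (by simp [hz]) hz0] at hI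
  have hscale := Measure.integral_comp_mul_left (fun x : ℝ =>
    (((Real.sigmoid x * (1 - Real.sigmoid x)) ^ 2 : ℝ) : ℂ) * Complex.exp (z * x)) 2
  rw [← hI] at hscale
  have hfun : (fun y : ℝ => ((sech y ^ 4 : ℝ) : ℂ) * Complex.exp (Complex.I * k * y)) =
      fun y : ℝ => 16 * ((((Real.sigmoid (2 * y) * (1 - Real.sigmoid (2 * y))) ^ 2 : ℝ) : ℂ) *
        Complex.exp (z * ((2 * y : ℝ) : ℂ))) := by
    funext y
    rw [sigmoid_mul_one_sub_sigmoid,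
      show z * ((2 * y : ℝ) : ℂ) = Complex.I * k * y by rw [hz]; push_cast; ring]
    push_cast
    ring
  have hsin : Complex.sin (Real.pi * z) =
      ((Real.sinh (Real.pi / 2 * k) : ℝ) : ℂ) * Complex.I := by
    rw [Complex.ofReal_sinh, ← Complex.sin_mul_I, hz]
    congr 1
    push_cast
    ring
  have hsinh : ((Real.sinh (Real.pi / 2 * k) : ℝ) : ℂ) ≠ 0 := by
    rw [Complex.ofReal_ne_zero, Real.sinh_ne_zero]
    exact mul_ne_zero (by positivity) hk
  rw [hfun, integral_const_mul, hscale, hsin, Complex.real_smul, cosech, hz]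
  push_cast
  rw [Complex.ofReal_sinh] at hsinh
  push_cast at hsinh
  rw [abs_of_pos (by norm_num : (0 : ℝ) < 2⁻¹)]
  push_cast
  field_simp
  rw [Complex.I_sq]
  ring

theorem integral_sech_pow_four_mul_tanh_mul_exp (k : ℝ) :
    (∫ y : ℝ, ((sech y ^ 4 : ℝ) : ℂ) * (k + 2 * Complex.I * ((Real.tanh y : ℝ) : ℂ)) *
        Complex.exp (Complex.I * k * y)) =
      k / 2 * ∫ y : ℝ, ((sech y ^ 4 : ℝ) : ℂ) * Complex.exp (Complex.I * k * y) := by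
  have hcexp : Continuous fun y : ℝ => Complex.exp (Complex.I * k * y) := by fun_prop
  have hnexp (y : ℝ) : ‖Complex.exp (Complex.I * k * y)‖ ≤ 1 := by
    rw [show Complex.I * k * y = ((k * y : ℝ) : ℂ) * Complex.I by push_cast; ring,
      Complex.norm_exp_ofReal_mul_I]
  have hF : Integrable fun y : ℝ => ((sech y ^ 4 : ℝ) : ℂ) * Complex.exp (Complex.I * k * y) :=
    integrable_sech_pow_four.ofReal.mul_bdd hcexp.aestronglyMeasurable
      (Filter.Eventually.of_forall hnexp)
  have hG : Integrable fun y : ℝ => ((sech y ^ 4 : ℝ) : ℂ) * Complex.exp (Complex.I * k * y) *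
      (k + 2 * Complex.I * ((Real.tanh y : ℝ) : ℂ)) := by
    refine hF.mul_bdd (c := |k| + 2) ?_ (Filter.Eventually.of_forall fun y => ?_)
    · exact Continuous.aestronglyMeasurable (continuous_const.add
        (continuous_const.mul (Complex.continuous_ofReal.comp continuous_tanh)))
    · refine (norm_add_le _ _).trans ?_
      have := (Real.abs_tanh_lt_one y).le
      simp only [norm_mul, Complex.norm_real, Complex.norm_I, Real.norm_eq_abs, Complex.norm_ofNat]
      linarith
  have hderiv (y : ℝ) : HasDerivAt
      (fun y : ℝ => -Complex.I / 2 * (((sech y ^ 4 : ℝ) : ℂ) * Complex.exp (Complex.I * k * y)))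
      (((sech y ^ 4 : ℝ) : ℂ) * Complex.exp (Complex.I * k * y) *
          (k + 2 * Complex.I * ((Real.tanh y : ℝ) : ℂ)) -
        k / 2 * (((sech y ^ 4 : ℝ) : ℂ) * Complex.exp (Complex.I * k * y))) y := by
    have h1 := ((hasDerivAt_sech y).pow 4).ofReal_comp
    have h2 : HasDerivAt (fun y : ℝ => Complex.exp (Complex.I * k * y))
        (Complex.exp (Complex.I * k * y) * (Complex.I * k)) y := by
      simpa using ((hasDerivAt_id y).ofReal_comp.const_mul (Complex.I * k)).cexp
    convert! (h1.mul h2).const_mul (-Complex.I / 2) using 1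
    rw [Pi.pow_apply]
    push_cast
    ring_nf
    rw [Complex.I_sq]
    ring
  have h0 := integral_eq_zero_of_hasDerivAt_of_integrable hderiv (hG.sub (hF.const_mul _))
    (hF.const_mul _)
  rw [integral_sub hG (hF.const_mul _), integral_const_mul, sub_eq_zero] at h0
  rw [← h0]
  exact integral_congr_ae (Filter.Eventually.of_forall fun y => by ring)

theorem Psi_cross_mul_phi_sq {ω : ℝ} (hω : 0 < ω) (x ξ₁ ξ₂ : ℝ) :
    (Psi1 ω x ξ₁ * Psi2 ω x ξ₂ - Psi2 ω x ξ₁ * Psi1 ω x ξ₂) * ((phi ω x ^ 2 : ℝ) : ℂ) =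
      ((ω ^ 2 * Real.sqrt ω / Real.pi * (ξ₁ - ξ₂) : ℝ) : ℂ) /
          ((((|ξ₁| : ℝ) : ℂ) - Complex.I * ((Real.sqrt ω : ℝ) : ℂ)) ^ 2 *
            (((|ξ₂| : ℝ) : ℂ) - Complex.I * ((Real.sqrt ω : ℝ) : ℂ)) ^ 2) *
        (((sech (Real.sqrt ω * x) ^ 4 : ℝ) : ℂ) *
            (((ξ₁ + ξ₂) / Real.sqrt ω : ℝ) +
              2 * Complex.I * ((Real.tanh (Real.sqrt ω * x) : ℝ) : ℂ)) *
          Complex.exp (Complex.I * ((ξ₁ + ξ₂) / Real.sqrt ω : ℝ) *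
            ((Real.sqrt ω * x : ℝ) : ℂ))) := by
  have ha : ((Real.sqrt ω : ℝ) : ℂ) ≠ 0 := by
    exact_mod_cast (Real.sqrt_pos.2 hω).ne'
  have hphi : phi ω x ^ 2 = 2 * ω * sech (Real.sqrt ω * x) ^ 2 := by
    rw [phi, mul_pow, Real.sq_sqrt (by positivity)]
  have hpi : (((Real.sqrt (2 * Real.pi) : ℝ) : ℂ)⁻¹) ^ 2 = (2 * (Real.pi : ℂ))⁻¹ := by
    rw [inv_pow, ← Complex.ofReal_pow, Real.sq_sqrt (by positivity)]
    push_cast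
    ring
  have hexp : Complex.exp (Complex.I * ((ξ₁ + ξ₂) / Real.sqrt ω : ℝ) *
      ((Real.sqrt ω * x : ℝ) : ℂ)) =
        Complex.exp (Complex.I * x * ξ₁) * Complex.exp (Complex.I * x * ξ₂) := by
    rw [← Complex.exp_add]
    congr 1
    push_cast
    field_simp
  have hnum : ((Real.sqrt ω : ℝ) : ℂ) * ((((ξ₁ + ξ₂) / Real.sqrt ω : ℝ) : ℂ) +
      2 * Complex.I * ((Real.tanh (Real.sqrt ω * x) : ℝ) : ℂ)) =
        ξ₁ + ξ₂ + 2 * Complex.I * ((Real.sqrt ω : ℝ) : ℂ) *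
          ((Real.tanh (Real.sqrt ω * x) : ℝ) : ℂ) := by
    push_cast
    field_simp
  rw [hexp, hphi]
  simp only [Psi1, Psi2]
  generalize (((|ξ₁| : ℝ) : ℂ) - Complex.I * ((Real.sqrt ω : ℝ) : ℂ)) ^ 2 = D₁
  generalize (((|ξ₂| : ℝ) : ℂ) - Complex.I * ((Real.sqrt ω : ℝ) : ℂ)) ^ 2 = D₂
  generalize Complex.exp (Complex.I * x * ξ₁) = E₁
  generalize Complex.exp (Complex.I * x * ξ₂) = E₂
  generalize (((ξ₁ + ξ₂) / Real.sqrt ω : ℝ) : ℂ) = q at hnum ⊢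
  generalize ((Real.sqrt (2 * Real.pi) : ℝ) : ℂ)⁻¹ = p at hpi ⊢
  push_cast
  push_cast at hnum
  generalize (Complex.tanh (((Real.sqrt ω : ℝ) : ℂ) * x)) = t at hnum ⊢
  generalize ((sech (Real.sqrt ω * x) : ℝ) : ℂ) = s
  generalize ((Real.sqrt ω : ℝ) : ℂ) = a at hnum ⊢
  linear_combination
    2 * ω ^ 2 * s ^ 4 * E₁ * E₂ * D₁⁻¹ * D₂⁻¹ *
        ((ξ₁ + Complex.I * a * t) ^ 2 - (ξ₂ + Complex.I * a * t) ^ 2) * hpi -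
      ω ^ 2 * (Real.pi : ℂ)⁻¹ * (ξ₁ - ξ₂) * s ^ 4 * E₁ * E₂ * D₁⁻¹ * D₂⁻¹ * hnum

/-- The quadratic spectral distribution `ν_{+-,ω}` carries the null factor
`(ξ₁² − ξ₂²)`, which cancels the time resonance in the modulation equations:
`∫ (Ψ₁,ω(x,ξ₁)Ψ₂,ω(x,ξ₂) − Ψ₂,ω(x,ξ₁)Ψ₁,ω(x,ξ₂)) φ_ω(x)² dx
  = (ξ₁² − ξ₂²) (1/12) (ξ₁² + 2ξ₁ξ₂ + ξ₂² + 4ω)/((|ξ₁| − i√ω)²(|ξ₂| − i√ω)²)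
      (ξ₁ + ξ₂) cosech((π/2)(ξ₁+ξ₂)/√ω)`. -/
theorem quadratic_spectral_distribution_plus_minus (ω : ℝ) (hω : 0 < ω) (ξ₁ ξ₂ : ℝ)
    (h : ξ₁ + ξ₂ ≠ 0) :
    (∫ x : ℝ, (Psi1 ω x ξ₁ * Psi2 ω x ξ₂ - Psi2 ω x ξ₁ * Psi1 ω x ξ₂) *
        ((phi ω x ^ 2 : ℝ) : ℂ)) =
      ((ξ₁ ^ 2 - ξ₂ ^ 2 : ℝ) : ℂ) * (1 / 12 : ℂ) *
        (((ξ₁ ^ 2 + 2 * ξ₁ * ξ₂ + ξ₂ ^ 2 + 4 * ω : ℝ) : ℂ) /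
          ((((|ξ₁| : ℝ) : ℂ) - Complex.I * ((Real.sqrt ω : ℝ) : ℂ)) ^ 2 *
            (((|ξ₂| : ℝ) : ℂ) - Complex.I * ((Real.sqrt ω : ℝ) : ℂ)) ^ 2)) *
        ((ξ₁ + ξ₂ : ℝ) : ℂ) *
        ((cosech (Real.pi / 2 * ((ξ₁ + ξ₂) / Real.sqrt ω)) : ℝ) : ℂ) := by

  have ha : 0 < Real.sqrt ω := Real.sqrt_pos.2 hω
  have hk : (ξ₁ + ξ₂) / Real.sqrt ω ≠ 0 := div_ne_zero h ha.ne'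
  rw [integral_congr_ae (Filter.Eventually.of_forall fun x => Psi_cross_mul_phi_sq hω x ξ₁ ξ₂),
    integral_const_mul,
    Measure.integral_comp_mul_left (fun y : ℝ => ((sech y ^ 4 : ℝ) : ℂ) *
      (((ξ₁ + ξ₂) / Real.sqrt ω : ℝ) + 2 * Complex.I * ((Real.tanh y : ℝ) : ℂ)) *
        Complex.exp (Complex.I * ((ξ₁ + ξ₂) / Real.sqrt ω : ℝ) * y)),
    integral_sech_pow_four_mul_tanh_mul_exp, integral_sech_pow_four_mul_exp hk,
    abs_of_pos (inv_pos.2 ha), Complex.real_smul]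
  have hreal : ω ^ 2 * Real.sqrt ω / Real.pi * (ξ₁ - ξ₂) * ((Real.sqrt ω)⁻¹ *
      ((ξ₁ + ξ₂) / Real.sqrt ω / 2 * (Real.pi * ((ξ₁ + ξ₂) / Real.sqrt ω) *
        (((ξ₁ + ξ₂) / Real.sqrt ω) ^ 2 + 4) / 6))) =
      (ξ₁ ^ 2 - ξ₂ ^ 2) * (1 / 12) * (ξ₁ ^ 2 + 2 * ξ₁ * ξ₂ + ξ₂ ^ 2 + 4 * ω) * (ξ₁ + ξ₂) := by
    obtain ⟨a, ha0, rfl⟩ : ∃ a : ℝ, 0 < a ∧ ω = a ^ 2 := ⟨_, ha, (Real.sq_sqrt hω.le).symm⟩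
    rw [Real.sqrt_sq ha0.le]
    field_simp
    ring
  have hcomplex := congrArg (fun r : ℝ => (r : ℂ)) hreal
  push_cast at hcomplex ⊢
  generalize (((|ξ₁| : ℝ) : ℂ) - Complex.I * ((Real.sqrt ω : ℝ) : ℂ)) ^ 2 = D₁
  generalize (((|ξ₂| : ℝ) : ℂ) - Complex.I * ((Real.sqrt ω : ℝ) : ℂ)) ^ 2 = D₂
  generalize ((cosech (Real.pi / 2 * ((ξ₁ + ξ₂) / Real.sqrt ω)) : ℝ) : ℂ) = c
  linear_combination D₁⁻¹ * D₂⁻¹ * c * hcomplex
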